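/- arXiv:1911.05615 — 3 statements merged into one kernel-verified Lean document; each statement's English description precedes it below -/
import Mathlib

section
/- If G(V,E) is a chordal graph with maximal cliques C_1,...,C_p, then a symmetric matrix X with sparsity pattern E is positive semidefinite completable (i.e., there exists a PSD matrix agreeing with X on the diagonal and on entries indexed by E) if and only if every principal submatrix X[C_ℓ, C_ℓ] indexed by a maximal clique C_ℓ is positive semidefinite. -/
/-- A graph is chordal if every cycle of length greater than three has a chord:
an edge between two nonconsecutive vertices of the cycle. -/
def IsChordal {V : Type*} (G : SimpleGraph V) : Prop :=
  ∀ (n : ℕ), 3 < n → ∀ f : ZMod n → V, Function.Injective f →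
    (∀ i, G.Adj (f i) (f (i + 1))) →
    ∃ i j : ZMod n, i ≠ j ∧ j ≠ i + 1 ∧ i ≠ j + 1 ∧ G.Adj (f i) (f j)

/-- A maximal clique of `G`, as a finite vertex set. -/
def IsMaxClique {V : Type*} (G : SimpleGraph V) (C : Finset V) : Prop :=
  G.IsClique (C : Set V) ∧ ∀ D : Finset V, G.IsClique (D : Set V) → C ⊆ D → C = D

lemma chordal_nat {V : Type*} {G : SimpleGraph V} (hG : IsChordal G) (m : ℕ) (hm : 3 < m)
    (f : ℕ → V) (hinj : ∀ i j, i < j → j < m → f i ≠ f j)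
    (hadj : ∀ i, i + 1 < m → G.Adj (f i) (f (i + 1))) (hlast : G.Adj (f (m - 1)) (f 0)) :
    ∃ i j, i + 1 < j ∧ j < m ∧ ¬ (i = 0 ∧ j = m - 1) ∧ G.Adj (f i) (f j) := by
  have : NeZero m := ⟨by omega⟩
  have : Fact (1 < m) := ⟨by omega⟩
  have hval : ∀ i : ZMod m, (i + 1).val = (i.val + 1) % m := by
    intro i
    rw [ZMod.val_add, ZMod.val_one]
  have hval1 : ∀ i : ZMod m, i.val + 1 < m → (i + 1).val = i.val + 1 := by
    intro i hi
    rw [hval, Nat.mod_eq_of_lt hi]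
  have hval2 : ∀ i : ZMod m, i.val + 1 = m → (i + 1).val = 0 := by
    intro i hi
    rw [hval, hi, Nat.mod_self]
  have hlt : ∀ i : ZMod m, i.val < m := fun i => ZMod.val_lt i
  obtain ⟨i, j, h1, h2, h3, h4⟩ := hG m hm (fun i => f i.val) (by
    intro i j hij
    apply ZMod.val_injective m
    by_contra hne
    rcases lt_or_gt_of_ne hne with h | h
    · exact hinj _ _ h (hlt j) hij
    · exact hinj _ _ h (hlt i) hij.symm) (by
    intro i
    rcases Nat.lt_or_ge (i.val + 1) m with h | h
    · simpa only [hval1 i h] using hadj _ h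
    · have h' : i.val + 1 = m := by have := hlt i; omega
      have h'' : i.val = m - 1 := by omega
      simpa only [hval2 i h', h''] using hlast)
  have k1 : i.val ≠ j.val := fun h => h1 (ZMod.val_injective m h)
  have k2 : j.val ≠ (i + 1).val := fun h => h2 (ZMod.val_injective m h)
  have k3 : i.val ≠ (j + 1).val := fun h => h3 (ZMod.val_injective m h)
  have a1 := hval1 i
  have a2 := hval2 i
  have a3 := hval1 j
  have a4 := hval2 j
  have l1 := hlt i
  have l2 := hlt j
  rcases lt_or_gt_of_ne k1 with h | h
  · exact ⟨i.val, j.val, by omega, by omega, by omega, h4⟩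
  · exact ⟨j.val, i.val, by omega, by omega, by omega, h4.symm⟩

lemma geodesic {V : Type*} {H : SimpleGraph V} {x y : V} (p : H.Walk x y)
    (hp : p.length = H.dist x y) {i j : ℕ} (hij : i ≤ j) (hj : j ≤ p.length)
    (q : H.Walk (p.getVert i) (p.getVert j)) : j ≤ i + q.length := by
  have h := SimpleGraph.dist_le (((p.take i).append q).append (p.drop j))
  simp only [SimpleGraph.Walk.length_append, SimpleGraph.Walk.take_length,
    SimpleGraph.Walk.drop_length] at h
  omega

/-- Two vertices adjacent to `a`, joined by a path avoiding the neighbourhood of `a`,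
are adjacent. -/
lemma adj_of_path {V : Type*} {G : SimpleGraph V} (hG : IsChordal G) (H : SimpleGraph V)
    (hHG : H ≤ G) (a x y : V) (hxy : x ≠ y) (hax : G.Adj a x) (hay : G.Adj a y)
    (hH : ∀ u w, H.Adj u w → u ≠ x → u ≠ y → u ≠ a ∧ ¬ G.Adj a u)
    (hHind : ∀ u w z t, H.Adj u w → H.Adj z t → G.Adj u z → H.Adj u z)
    (hr : H.Reachable x y) : G.Adj x y := by
  by_contra hnadj
  obtain ⟨p, hp⟩ := hr.exists_walk_length_eq_dist
  have hk : 1 < p.length := by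
    rw [hp]
    exact hr.one_lt_dist_of_ne_of_not_adj hxy (fun h => hnadj (hHG h))
  have hpinj : ∀ i j, i < j → j ≤ p.length → p.getVert i ≠ p.getVert j := by
    intro i j hij hj he
    have := geodesic p hp hij.le hj (SimpleGraph.Walk.nil.copy rfl he)
    simp at this
    omega
  have hadjH : ∀ i, i ≤ p.length → ∃ w, H.Adj (p.getVert i) w := by
    intro i hi
    rcases Nat.lt_or_ge i p.length with h | h
    · exact ⟨_, p.adj_getVert_succ h⟩
    · have h2 := p.adj_getVert_succ (i := i - 1) (by omega)
      rw [show i - 1 + 1 = i by omega] at h2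
      exact ⟨_, h2.symm⟩
  have hchord : ∀ i j, i < j → j ≤ p.length → G.Adj (p.getVert i) (p.getVert j) → j ≤ i + 1 := by
    intro i j hij hj he
    obtain ⟨w, hw⟩ := hadjH i (by omega)
    obtain ⟨t, ht⟩ := hadjH j hj
    have := geodesic p hp hij.le hj (hHind _ _ _ _ hw ht he).toWalk
    simpa using this
  have hint : ∀ i, 0 < i → i < p.length → p.getVert i ≠ a ∧ ¬ G.Adj a (p.getVert i) := by
    intro i h0 hi
    obtain ⟨w, hw⟩ := hadjH i hi.le
    refine hH _ _ hw ?_ ?_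
    · have := hpinj 0 i h0 hi.le
      rw [p.getVert_zero] at this
      exact this.symm
    · have := hpinj i p.length hi le_rfl
      rwa [p.getVert_length] at this
  have hna : ∀ i, i ≤ p.length → p.getVert i ≠ a := by
    intro i hi
    rcases Nat.eq_zero_or_pos i with h | h
    · subst h; rw [p.getVert_zero]; exact hax.ne'
    · rcases Nat.lt_or_ge i p.length with h' | h'
      · exact (hint i h h').1
      · have : i = p.length := by omega
        subst this; rw [p.getVert_length]; exact hay.ne'
  obtain ⟨i, j, h1, h2, h3, h4⟩ := chordal_nat hG (p.length + 2) (by omega)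
    (fun i => if i ≤ p.length then p.getVert i else a) (by
      intro i j hij hj
      rw [if_pos (show i ≤ p.length by omega)]
      split_ifs with h
      · exact hpinj i j hij h
      · exact hna i (by omega)) (by
      intro i hi
      rw [if_pos (show i ≤ p.length by omega)]
      split_ifs with h
      · exact hHG (p.adj_getVert_succ h)
      · have : i = p.length := by omega
        subst this; rw [p.getVert_length]; exact hay.symm) (by
      rw [if_neg (by omega), if_pos (by omega), p.getVert_zero]; exact hax)
  rw [if_pos (show i ≤ p.length by omega)] at h4
  split_ifs at h4 with h
  · have := hchord i j (by omega) h h4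
    omega
  · exact (hint i (by omega) (by omega)).2 h4.symm

/-- Dirac's lemma, in a form suitable for induction. -/
lemma dirac {V : Type*} [DecidableEq V] {G : SimpleGraph V} (hG : IsChordal G) :
    ∀ (k : ℕ) (S B : Finset V), S.card = k → B ⊆ S → G.IsClique (B : Set V) → B ≠ S →
    ∃ s ∈ S, s ∉ B ∧ ∀ u ∈ S, ∀ w ∈ S, G.Adj s u → G.Adj s w → u ≠ w → G.Adj u w := by
  classical
  intro k
  induction k using Nat.strong_induction_on with
  | _ k ih =>
  intro S B hk hBS hB hne
  by_cases hS : G.IsClique (S : Set V)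
  · obtain ⟨s, hs, hsB⟩ := Finset.exists_of_ssubset (hBS.ssubset_of_ne hne)
    exact ⟨s, hs, hsB, fun u hu w hw _ _ huw => hS hu hw huw⟩
  obtain ⟨a, haS, ⟨c, hcS, hca, hnac⟩, haB⟩ : ∃ a ∈ S, (∃ c ∈ S, c ≠ a ∧ ¬ G.Adj a c) ∧
      (∀ s ∈ S, s ≠ a → ¬ G.Adj a s → s ∉ B) := by
    by_cases h : ∃ a ∈ B, ∃ c ∈ S, c ≠ a ∧ ¬ G.Adj a c
    · obtain ⟨a, ha, h⟩ := h
      exact ⟨a, hBS ha, h, fun s _ hsa hn hsB => hn (hB ha hsB hsa.symm)⟩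
    · push Not at h
      have : ∃ a ∈ S, ∃ c ∈ S, c ≠ a ∧ ¬ G.Adj a c := by
        by_contra hcon
        push Not at hcon
        exact hS fun u hu w hw huw => hcon u hu w hw huw.symm
      obtain ⟨a, ha, h'⟩ := this
      exact ⟨a, ha, h', fun s _ hsa hn hsB => hn (h s hsB a ha hsa.symm).symm⟩
  let D : V → Prop := fun u => u ∈ S ∧ u ≠ a ∧ ¬ G.Adj a u
  let K : SimpleGraph V :=
    { Adj := fun u w => G.Adj u w ∧ D u ∧ D w
      symm := ⟨fun u w h => ⟨h.1.symm, h.2.2, h.2.1⟩⟩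
      loopless := ⟨fun u h => G.loopless.irrefl u h.1⟩ }
  let C : Finset V := S.filter fun u => D u ∧ K.Reachable c u
  let B' : Finset V := S.filter fun u => u ∉ C ∧ ∃ w ∈ C, G.Adj w u
  have hC : ∀ u, u ∈ C ↔ D u ∧ K.Reachable c u := by
    intro u
    simp only [C, Finset.mem_filter]
    exact ⟨fun h => h.2, fun h => ⟨h.1.1, h⟩⟩
  have hB'mem : ∀ u, u ∈ B' ↔ u ∈ S ∧ u ∉ C ∧ ∃ w ∈ C, G.Adj w u := by
    intro u
    simp only [B', Finset.mem_filter]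
  have hcC : c ∈ C := (hC c).2 ⟨⟨hcS, hca, hnac⟩, SimpleGraph.Reachable.refl _⟩
  have hB'a : ∀ u ∈ B', G.Adj a u := by
    intro u hu
    obtain ⟨huS, huC, w, hw, hwu⟩ := (hB'mem u).1 hu
    obtain ⟨hwD, hwr⟩ := (hC w).1 hw
    by_contra hn
    have hua : u ≠ a := by
      rintro rfl
      exact hwD.2.2 hwu.symm
    have hD : D u := ⟨huS, hua, hn⟩
    have hK : K.Adj w u := ⟨hwu, hwD, hD⟩
    exact huC ((hC u).2 ⟨hD, hwr.trans hK.reachable⟩)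
  have hB'cl : G.IsClique (B' : Set V) := by
    intro x hx y hy hxy
    have hx' : x ∈ B' := hx
    have hy' : y ∈ B' := hy
    obtain ⟨hxS, hxC, wx, hwx, hwxx⟩ := (hB'mem x).1 hx'
    obtain ⟨hyS, hyC, wy, hwy, hwyy⟩ := (hB'mem y).1 hy'
    let E : V → Prop := fun u => D u ∨ u = x ∨ u = y
    let H : SimpleGraph V :=
      { Adj := fun u w => G.Adj u w ∧ E u ∧ E w
        symm := ⟨fun u w h => ⟨h.1.symm, h.2.2, h.2.1⟩⟩
        loopless := ⟨fun u h => G.loopless.irrefl u h.1⟩ }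
    have hKH : K ≤ H := fun u w h => ⟨h.1, Or.inl h.2.1, Or.inl h.2.2⟩
    have hwx2 := (hC wx).1 hwx
    have hwy2 := (hC wy).1 hwy
    have e1 : H.Adj x wx := ⟨hwxx.symm, Or.inr (Or.inl rfl), Or.inl hwx2.1⟩
    have e2 : H.Adj wy y := ⟨hwyy, Or.inl hwy2.1, Or.inr (Or.inr rfl)⟩
    have hr : H.Reachable x y :=
      e1.reachable.trans (((hwx2.2.symm.trans hwy2.2).mono hKH).trans e2.reachable)
    refine adj_of_path hG H (fun u w h => h.1) a x y hxy (hB'a x hx') (hB'a y hy') ?_ ?_ hr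
    · intro u w h hux huy
      rcases h.2.1 with h | h | h
      · exact h.2
      · exact absurd h hux
      · exact absurd h huy
    · intro u w z t h1 h2 h3
      exact ⟨h3, h1.2.1, h2.2.1⟩
  have haC : a ∉ C := fun h => ((hC a).1 h).1.2.1 rfl
  have haB' : a ∉ B' := fun h => G.loopless.irrefl a (hB'a a h)
  have hcB' : c ∉ B' := fun h => ((hB'mem c).1 h).2.1 hcC
  have hsub : C ∪ B' ⊂ S := by
    refine Finset.ssubset_iff_subset_ne.2 ⟨Finset.union_subset (Finset.filter_subset _ _)
      (Finset.filter_subset _ _), ?_⟩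
    intro h
    rw [← h, Finset.mem_union] at haS
    tauto
  obtain ⟨s, hs, hsB', hsimp⟩ := ih _ (hk ▸ Finset.card_lt_card hsub) (C ∪ B') B' rfl
    Finset.subset_union_right hB'cl (by
      intro h
      apply hcB'
      rw [h]
      exact Finset.mem_union_left _ hcC)
  have hsC : s ∈ C := by
    rcases Finset.mem_union.1 hs with h | h
    · exact h
    · exact absurd h hsB'
  have hsD := ((hC s).1 hsC).1
  refine ⟨s, hsD.1, haB s hsD.1 hsD.2.1 hsD.2.2, ?_⟩
  have hnb : ∀ u ∈ S, G.Adj s u → u ∈ C ∪ B' := by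
    intro u hu hsu
    by_cases h : u ∈ C
    · exact Finset.mem_union_left _ h
    · exact Finset.mem_union_right _ ((hB'mem u).2 ⟨hu, h, s, hsC, hsu⟩)
  intro u hu w hw h1 h2 h3
  exact hsimp u (hnb u hu h1) w (hnb w hw h2) h1 h2 h3

lemma exists_gram {ι : Type*} [Finite ι] (M : Matrix ι ι ℝ) (hM : M.PosSemidef) :
    ∃ (m : ℕ) (h : ι → EuclideanSpace ℝ (Fin m)), ∀ i j, inner ℝ (h i) (h j) = M i j := by
  obtain ⟨m, v, hv⟩ := Matrix.posSemidef_iff_eq_sum_vecMulVec.1 hM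
  refine ⟨m, fun i => WithLp.toLp 2 fun k => v k i, fun i j => ?_⟩
  rw [hv, Matrix.sum_apply]
  simp [PiLp.inner_apply, Matrix.vecMulVec_apply, mul_comm]

lemma exists_coeff {V E : Type*} [NormedAddCommGroup E] [InnerProductSpace ℝ E]
    [FiniteDimensional ℝ E] (h : V → E) (s : Finset V) (v : V) :
    ∃ (c : V → ℝ) (ρ : ℝ), 0 ≤ ρ ∧
      (∀ i ∈ s, inner ℝ (h i) (h v) = ∑ k ∈ s, c k * inner ℝ (h i) (h k)) ∧
      inner ℝ (h v) (h v) = (∑ l ∈ s, c l * ∑ k ∈ s, c k * inner ℝ (h l) (h k)) + ρ := by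
  obtain ⟨y, hy, z, hz, hyz⟩ :=
    (Submodule.span ℝ (h '' (s : Set V))).exists_add_mem_mem_orthogonal (h v)
  obtain ⟨c, hc⟩ := (Submodule.mem_span_image_finset_iff_exists_fun' ℝ).1 hy
  have hyz0 : inner ℝ y z = 0 := (Submodule.mem_orthogonal _ _).1 hz y hy
  have hi0 : ∀ i ∈ s, inner ℝ (h i) z = 0 := fun i hi =>
    (Submodule.mem_orthogonal _ _).1 hz _ (Submodule.subset_span ⟨i, hi, rfl⟩)
  refine ⟨c, inner ℝ z z, real_inner_self_nonneg, ?_, ?_⟩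
  · intro i hi
    rw [hyz, inner_add_right, hi0 i hi, ← hc, inner_sum]
    simp [inner_smul_right]
  · rw [hyz, inner_add_right, inner_add_left, inner_add_left, hyz0, real_inner_comm y z, hyz0]
    simp only [zero_add, add_zero]
    congr 1
    rw [← hc, sum_inner]
    simp [inner_smul_left, inner_sum, inner_smul_right, Finset.mul_sum, mul_left_comm]

lemma clique_psd {n : ℕ} (G : SimpleGraph (Fin n)) (X : Matrix (Fin n) (Fin n) ℝ)
    (hX : ∀ C : Finset (Fin n), IsMaxClique G C →
        (X.submatrix (fun i : C => (i : Fin n)) (fun i : C => (i : Fin n))).PosSemidef)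
    (D : Finset (Fin n)) (hD : G.IsClique (D : Set (Fin n))) :
    ∃ (m : ℕ) (h : Fin n → EuclideanSpace ℝ (Fin m)),
      ∀ i ∈ D, ∀ j ∈ D, inner ℝ (h i) (h j) = X i j := by
  classical
  obtain ⟨C, hDC, hC⟩ := Finite.exists_le_maximal
    (p := fun C : Finset (Fin n) => G.IsClique (C : Set (Fin n))) hD
  have hmax : IsMaxClique G C := ⟨hC.1, fun D' h1 h2 => le_antisymm h2 (hC.2 h1 h2)⟩
  obtain ⟨m, h, hh⟩ := exists_gram _ (hX C hmax)
  refine ⟨m, fun i => if hi : i ∈ C then h ⟨i, hi⟩ else 0, fun i hi j hj => ?_⟩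
  beta_reduce
  rw [dif_pos (hDC hi), dif_pos (hDC hj), hh]
  rfl

lemma completion {n : ℕ} (G : SimpleGraph (Fin n)) (hG : IsChordal G)
    (X : Matrix (Fin n) (Fin n) ℝ) (hsymm : X.IsSymm)
    (hX : ∀ C : Finset (Fin n), IsMaxClique G C →
        (X.submatrix (fun i : C => (i : Fin n)) (fun i : C => (i : Fin n))).PosSemidef) :
    ∀ (k : ℕ) (S : Finset (Fin n)), S.card = k → ∃ Y : Matrix (Fin n) (Fin n) ℝ, Y.PosSemidef ∧
        ∀ i ∈ S, ∀ j ∈ S, (i = j ∨ G.Adj i j) → X i j = Y i j := by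
  classical
  intro k
  induction k with
  | zero =>
    intro S hS
    rw [Finset.card_eq_zero] at hS
    subst hS
    exact ⟨0, Matrix.PosSemidef.zero, by simp⟩
  | succ k ih =>
    intro S hS
    obtain ⟨v, hv, -, hsimp⟩ := dirac hG _ S ∅ rfl (Finset.empty_subset _) (by simp) (by
      rintro rfl
      simp at hS)
    obtain ⟨Y', hY', hYX⟩ := ih (S.erase v) (by rw [Finset.card_erase_of_mem hv, hS]; rfl)
    let N : Finset (Fin n) := S.filter fun u => G.Adj v u
    have hN : ∀ u, u ∈ N ↔ u ∈ S ∧ G.Adj v u := by simp [N]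
    have hNcl : ∀ i ∈ N, ∀ j ∈ N, i = j ∨ G.Adj i j := by
      intro i hi j hj
      by_cases hij : i = j
      · exact Or.inl hij
      · exact Or.inr (hsimp i ((hN i).1 hi).1 j ((hN j).1 hj).1 ((hN i).1 hi).2 ((hN j).1 hj).2 hij)
    have hcl : G.IsClique ((insert v N : Finset (Fin n)) : Set (Fin n)) := by
      rw [Finset.coe_insert, SimpleGraph.isClique_insert]
      exact ⟨fun i hi j hj hij => (hNcl i hi j hj).resolve_left hij,
        fun u hu _ => ((hN u).1 hu).2⟩
    obtain ⟨m, h, hh⟩ := clique_psd G X hX _ hcl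
    obtain ⟨c, ρ, hρ, hc1, hc2⟩ := exists_coeff h N v
    obtain ⟨m', g, hg⟩ := exists_gram Y' hY'
    have hvI : v ∈ insert v N := Finset.mem_insert_self _ _
    have hNI : ∀ {i}, i ∈ N → i ∈ insert v N := fun hi => Finset.mem_insert_of_mem hi
    have hNS : ∀ i ∈ N, i ∈ S.erase v := fun i hi =>
      Finset.mem_erase.2 ⟨((hN i).1 hi).2.ne', ((hN i).1 hi).1⟩
    have hgN : ∀ i ∈ N, ∀ j ∈ N, inner ℝ (h i) (h j) = inner ℝ (g i) (g j) := by
      intro i hi j hj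
      rw [hg, hh i (hNI hi) j (hNI hj)]
      exact hYX i (hNS i hi) j (hNS j hj) (hNcl i hi j hj)
    let gv := ∑ k ∈ N, c k • g k
    have h1 : ∀ i ∈ N, X i v = inner ℝ (g i) gv := by
      intro i hi
      rw [← hh i (hNI hi) v hvI, hc1 i hi, inner_sum]
      refine Finset.sum_congr rfl fun k hk => ?_
      rw [inner_smul_right, hgN i hi k hk]
    have h2 : X v v = inner ℝ gv gv + ρ := by
      rw [← hh v hvI v hvI, hc2]
      congr 1
      conv_rhs => rw [show gv = ∑ k ∈ N, c k • g k from rfl, sum_inner]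
      refine Finset.sum_congr rfl fun l hl => ?_
      rw [inner_smul_left, inner_sum]
      congr 1
      refine Finset.sum_congr rfl fun k hk => ?_
      rw [inner_smul_right, hgN l hl k hk]
    refine ⟨Matrix.gram ℝ (Function.update g v gv) + Matrix.diagonal (Pi.single v ρ),
      (Matrix.posSemidef_gram ℝ _).add (Matrix.PosSemidef.diagonal ?_), ?_⟩
    · intro i
      by_cases hi : i = v
      · subst hi; simpa using hρ
      · simp [hi]
    · intro i hi j hj hij
      rw [Matrix.add_apply, Matrix.gram_apply]
      by_cases hiv : i = v
      · subst hiv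
        by_cases hji : j = i
        · subst hji
          simpa using h2
        · have hadj : G.Adj i j := hij.resolve_left (Ne.symm hji)
          rw [← hsymm.apply, h1 j ((hN j).2 ⟨hj, hadj⟩)]
          simp [hji, Matrix.diagonal_apply_ne' _ hji, real_inner_comm]
      · by_cases hjv : j = v
        · subst hjv
          have hadj : G.Adj i j := hij.resolve_left hiv
          rw [h1 i ((hN i).2 ⟨hi, hadj.symm⟩)]
          simp [hiv]
        · rw [hYX i (Finset.mem_erase.2 ⟨hiv, hi⟩) j (Finset.mem_erase.2 ⟨hjv, hj⟩) hij]
          have : (Matrix.diagonal (Pi.single v ρ) : Matrix (Fin n) (Fin n) ℝ) i j = 0 := by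
            by_cases hij : i = j
            · subst hij; simp [hiv]
            · simp [hij]
          simp [hiv, hjv, hg, this]

/-- **Grone's theorem.** For a chordal sparsity graph `G(V,E)`, a symmetric matrix `X`
with sparsity pattern `E` is positive semidefinite completable (there is a PSD matrix
agreeing with `X` on the diagonal and on entries indexed by `E`) iff every principal
submatrix indexed by a maximal clique is positive semidefinite. -/
theorem grone_theorem {n : ℕ} (G : SimpleGraph (Fin n)) (hG : IsChordal G)
    (X : Matrix (Fin n) (Fin n) ℝ) (hsymm : X.IsSymm)
    (hsupp : ∀ i j, i ≠ j → ¬ G.Adj i j → X i j = 0) :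
    (∃ Y : Matrix (Fin n) (Fin n) ℝ, Y.PosSemidef ∧
        ∀ i j, (i = j ∨ G.Adj i j) → X i j = Y i j) ↔
      (∀ C : Finset (Fin n), IsMaxClique G C →
        (X.submatrix (fun i : C => (i : Fin n)) (fun i : C => (i : Fin n))).PosSemidef) := by
  constructor
  · rintro ⟨Y, hY, hXY⟩ C hC
    have : X.submatrix (fun i : C => (i : Fin n)) (fun i : C => (i : Fin n)) =
        Y.submatrix (fun i : C => (i : Fin n)) (fun i : C => (i : Fin n)) := by
      ext i j
      refine hXY _ _ ?_
      by_cases hij : (i : Fin n) = j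
      · exact Or.inl hij
      · exact Or.inr (hC.1 i.2 j.2 hij)
    rw [this]
    exact hY.submatrix _
  · intro hX
    obtain ⟨Y, hY, h⟩ := completion G hG X hsymm hX _ Finset.univ rfl
    exact ⟨Y, hY, fun i j hij => h i (Finset.mem_univ _) j (Finset.mem_univ _) hij⟩
end

section
/- Any maximum weight spanning tree of the clique graph of a chordal graph, with edge weights w̃_ij = |C_i ∩ C_j|, satisfies the running-intersection property (i.e., is a valid clique tree). -/
/-- The running-intersection property of a tree `T` on the clique map `C`. -/
def RIP {ι α : Type*} [DecidableEq α] (T : SimpleGraph ι) (C : ι → Finset α) : Prop :=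
  ∀ (i j : ι) (w : T.Walk i j), w.IsPath → ∀ k ∈ w.support, C i ∩ C j ⊆ C k

open Classical in
/-- Total edge weight of a graph `T` on the cliques, with edge weights
`|C_i ∩ C_j|` (each edge counted twice). -/
noncomputable def treeWeight {V : Type*} [DecidableEq V] {p : ℕ}
    (C : Fin p → Finset V) (T : SimpleGraph (Fin p)) : ℕ :=
  ∑ ℓ, ∑ m, if T.Adj ℓ m then (C ℓ ∩ C m).card else 0

open SimpleGraph

/-- The cycle argument: a vertex adjacent to both ends of an induced path in a chordal graph is
adjacent to every vertex of the path. -/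
lemma fan_lemma {V : Type*} (G : SimpleGraph V) (hchord : IsChordal G) (n : ℕ) (u : ℕ → V)
    (x : V) (hadj : ∀ t, t < n → G.Adj (u t) (u (t + 1)))
    (hind : ∀ s t, s + 1 < t → t ≤ n → ¬ G.Adj (u s) (u t))
    (hne : ∀ s t, s < t → t ≤ n → u s ≠ u t)
    (hx : ∀ t, t ≤ n → x ≠ u t) (h0 : G.Adj x (u 0)) (hn : G.Adj x (u n)) :
    ∀ t, t ≤ n → G.Adj x (u t) := by
  classical
  intro t ht
  by_contra hcon
  obtain ⟨l, hlt, hl, hlmax⟩ : ∃ l, l < t ∧ G.Adj x (u l) ∧ ∀ s, l < s → s ≤ t → ¬ G.Adj x (u s) := by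
    refine ⟨Nat.findGreatest (fun s => G.Adj x (u s)) t, ?_, ?_, ?_⟩
    · have h1 := Nat.findGreatest_le (P := fun s => G.Adj x (u s)) t
      have h2 : G.Adj x (u (Nat.findGreatest (fun s => G.Adj x (u s)) t)) :=
        Nat.findGreatest_spec (P := fun s => G.Adj x (u s)) (Nat.zero_le t) h0
      rcases h1.lt_or_eq with h | h
      · exact h
      · rw [h] at h2; exact absurd h2 hcon
    · exact Nat.findGreatest_spec (P := fun s => G.Adj x (u s)) (Nat.zero_le t) h0
    · intro s hs hst
      exact Nat.findGreatest_is_greatest hs hst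
  obtain ⟨r, htr, hrn, hr, hrmin⟩ : ∃ r, t < r ∧ r ≤ n ∧ G.Adj x (u r) ∧
      ∀ s, t ≤ s → s < r → ¬ G.Adj x (u s) := by
    have hex : ∃ s, t ≤ s ∧ G.Adj x (u s) := ⟨n, ht, hn⟩
    have hsp := Nat.find_spec hex
    refine ⟨Nat.find hex, ?_, Nat.find_min' hex ⟨ht, hn⟩, hsp.2, ?_⟩
    · rcases hsp.1.lt_or_eq with h | h
      · exact h
      · rw [← h] at hsp; exact absurd hsp.2 hcon
    · intro s hs hsr ha
      exact Nat.find_min hex hsr ⟨hs, ha⟩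
  have hmid : ∀ s, l < s → s < r → ¬ G.Adj x (u s) := by
    intro s h1 h2
    rcases le_total s t with h | h
    · exact hlmax s h1 h
    · exact hrmin s h h2
  obtain ⟨m, hm⟩ : ∃ m, m = r - l + 2 := ⟨_, rfl⟩
  have hm3 : 3 < m := by omega
  have : NeZero m := ⟨by omega⟩
  have : Fact (1 < m) := ⟨by omega⟩
  let g : ℕ → V := fun a => if a = 0 then x else u (l + a - 1)
  have hg0 : g 0 = x := by simp [g]
  have hgs : ∀ a, 0 < a → g a = u (l + a - 1) := fun a ha => by simp [g, ha.ne']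
  have hval : ∀ i : ZMod m, (i + 1).val = (i.val + 1) % m := by
    intro i; rw [ZMod.val_add, ZMod.val_one]
  have hlt' : ∀ i : ZMod m, i.val < m := fun i => ZMod.val_lt i
  have gne : ∀ a b, a < b → b < m → g a ≠ g b := by
    intro a b hab hb
    rw [hgs b (by omega)]
    rcases Nat.eq_zero_or_pos a with rfl | ha
    · rw [hg0]; exact hx _ (by omega)
    · rw [hgs a ha]; exact hne _ _ (by omega) (by omega)
  have gnadj : ∀ a b, a < b → b < m → b ≠ (a + 1) % m → a ≠ (b + 1) % m → ¬ G.Adj (g a) (g b) := by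
    intro a b hab hb h1 h2
    rw [Nat.mod_eq_of_lt (by omega)] at h1
    rw [hgs b (by omega)]
    rcases Nat.eq_zero_or_pos a with rfl | ha
    · have : b + 1 ≠ m := by
        rintro h; rw [h, Nat.mod_self] at h2; exact h2 rfl
      rw [hg0]; exact hmid _ (by omega) (by omega)
    · rw [hgs a ha]; exact hind _ _ (by omega) (by omega)
  obtain ⟨i, j, hij, hj, hi, hA⟩ := hchord m hm3 (fun i => g i.val) (by
    intro i j h
    apply ZMod.val_injective m
    rcases lt_trichotomy i.val j.val with h' | h' | h'
    · exact absurd h (gne _ _ h' (hlt' j))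
    · exact h'
    · exact absurd h.symm (gne _ _ h' (hlt' i))) (by
    intro i
    show G.Adj (g i.val) (g (i + 1).val)
    rw [hval]
    have := hlt' i
    rcases Nat.lt_or_ge (i.val + 1) m with h | h
    · rw [Nat.mod_eq_of_lt h, hgs (i.val + 1) (by omega)]
      rcases Nat.eq_zero_or_pos i.val with h0 | h0
      · rw [h0, hg0]; exact hl
      · rw [hgs _ h0]
        have := hadj (l + i.val - 1) (by omega)
        rwa [show l + i.val - 1 + 1 = l + (i.val + 1) - 1 by omega] at this
    · have h' : i.val + 1 = m := by omega
      rw [h', Nat.mod_self, hg0, hgs _ (by omega), show l + i.val - 1 = r by omega]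
      exact hr.symm)
  have hij' : i.val ≠ j.val := fun h => hij (ZMod.val_injective m h)
  have hj' : j.val ≠ (i.val + 1) % m := fun h => hj (ZMod.val_injective m (by rw [hval, h]))
  have hi' : i.val ≠ (j.val + 1) % m := fun h => hi (ZMod.val_injective m (by rw [hval, h]))
  rcases lt_or_gt_of_ne hij' with h | h
  · exact gnadj _ _ h (hlt' j) hj' hi' hA
  · exact gnadj _ _ h (hlt' i) hi' hj' hA.symm

/-- Shortest walks are induced paths. -/
lemma exists_induced {V : Type*} (G : SimpleGraph V) {p q : V} (h : G.Reachable p q) :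
    ∃ (n : ℕ) (u : ℕ → V), u 0 = p ∧ u n = q ∧ (∀ t, t < n → G.Adj (u t) (u (t + 1))) ∧
      (∀ s t, s + 1 < t → t ≤ n → ¬ G.Adj (u s) (u t)) ∧
      (∀ s t, s < t → t ≤ n → u s ≠ u t) := by
  obtain ⟨w, hw⟩ := h.exists_walk_length_eq_dist
  have key : ∀ s t, s < t → t ≤ w.length → ∀ c : G.Walk (w.getVert s) (w.getVert t),
      t ≤ s + c.length := by
    intro s t hst ht c
    have := dist_le (((w.take s).append c).append (w.drop t))
    rw [← hw] at this
    simp [Walk.length_append, Walk.take_length, Walk.drop_length] at this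
    omega
  refine ⟨w.length, w.getVert, by simp, by simp, fun t ht => w.adj_getVert_succ ht, ?_, ?_⟩
  · intro s t hst ht ha
    have := key s t (by omega) ht ha.toWalk
    simp at this; omega
  · intro s t hst ht he
    have := key s t hst ht (Walk.nil.copy rfl he)
    simp at this; omega

/-- `G` with all edges touching `M` removed. -/
def awayFrom {V : Type*} (G : SimpleGraph V) (M : Finset V) : SimpleGraph V where
  Adj a b := G.Adj a b ∧ a ∉ M ∧ b ∉ M
  symm := ⟨fun _ _ h => ⟨h.1.symm, h.2.2, h.2.1⟩⟩
  loopless := ⟨fun _ h => h.1.ne rfl⟩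

lemma exists_maxClique {V : Type*} [Fintype V] (G : SimpleGraph V) (D : Finset V)
    (hD : G.IsClique (D : Set V)) : ∃ E, IsMaxClique G E ∧ D ⊆ E := by
  classical
  obtain ⟨E, hE, hmax⟩ := Finset.exists_max_image
    (Finset.univ.filter fun E : Finset V => G.IsClique (E : Set V) ∧ D ⊆ E) Finset.card
    ⟨D, by simp [hD]⟩
  simp only [Finset.mem_filter, Finset.mem_univ, true_and] at hE hmax
  exact ⟨E, ⟨hE.1, fun F hF hEF => Finset.eq_of_subset_of_card_le hEF
    (hmax F ⟨hF, hE.2.trans hEF⟩)⟩, hE.2⟩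

lemma chain_lemma {V : Type*} [Fintype V] [DecidableEq V]
    (G : SimpleGraph V) (hchord : IsChordal G) {p : ℕ} (C : Fin p → Finset V)
    (hmax : ∀ ℓ, IsMaxClique G (C ℓ))
    (hcov : ∀ D : Finset V, IsMaxClique G D → ∃ ℓ, C ℓ = D)
    (M : Finset V) (k l : Fin p) (hk : M ⊆ C k) (hl : M ⊆ C l)
    (a b : V) (ha : a ∈ C k) (haM : a ∉ M) (hb : b ∈ C l) (hbM : b ∉ M)
    (hab : (awayFrom G M).Reachable a b) (Side : Fin p → Prop)
    (hside : ∀ x y, M.card < (C x ∩ C y).card → Side x → Side y) (hsk : Side k) : Side l := by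
  obtain ⟨n, u, hu0, hun, hadj, hind, hne⟩ := exists_induced _ hab
  have huM : ∀ t, t ≤ n → u t ∉ M := by
    intro t ht
    rcases Nat.eq_zero_or_pos t with rfl | h
    · rwa [hu0]
    · have := (hadj (t - 1) (by omega)).2.2
      rwa [show t - 1 + 1 = t by omega] at this
  have hfan : ∀ x ∈ M, ∀ t, t ≤ n → G.Adj x (u t) := by
    intro x hx
    refine fan_lemma G hchord n u x (fun t ht => (hadj t ht).1) ?_ hne ?_ ?_ ?_
    · intro s t hst ht h
      exact hind s t hst ht ⟨h, huM s (by omega), huM t ht⟩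
    · rintro t ht rfl; exact huM t ht hx
    · rw [hu0]; exact (hmax k).1 (hk hx) ha (by rintro rfl; exact haM hx)
    · rw [hun]; exact (hmax l).1 (hl hx) hb (by rintro rfl; exact hbM hx)
  have step : ∀ x y v, v ∉ M → M ⊆ C x → M ⊆ C y → v ∈ C x → v ∈ C y → Side x → Side y := by
    intro x y v hv hMx hMy hvx hvy
    refine hside x y ?_
    have : insert v M ⊆ C x ∩ C y := by
      intro z hz
      rcases Finset.mem_insert.1 hz with rfl | hz
      · simp [hvx, hvy]
      · simp [hMx hz, hMy hz]
    have := Finset.card_le_card this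
    rw [Finset.card_insert_of_notMem hv] at this
    omega
  have hind' : ∀ t, t ≤ n → ∀ x, M ⊆ C x → u t ∈ C x → Side x := by
    intro t
    induction t with
    | zero =>
      intro _ x hMx hux
      exact step k x (u 0) (huM 0 (by omega)) hk hMx (hu0 ▸ ha) hux hsk
    | succ t ih =>
      intro ht x hMx hux
      obtain ⟨E, hE, hDE⟩ := exists_maxClique G (insert (u t) (insert (u (t+1)) M)) (by
        rw [Finset.coe_insert, Finset.coe_insert, isClique_insert, isClique_insert]
        refine ⟨⟨(hmax k).1.subset (by exact_mod_cast hk), ?_⟩, ?_⟩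
        · intro z hz _
          exact (hfan z hz (t+1) ht).symm
        · intro z hz _
          rcases hz with rfl | hz
          · exact (hadj t (by omega)).1
          · exact (hfan z hz t (by omega)).symm)
      obtain ⟨y, rfl⟩ := hcov E hE
      have hMy : M ⊆ C y := fun z hz => hDE (by simp [hz])
      exact step y x (u (t+1)) (huM _ ht) hMy hMx (hDE (by simp)) hux
        (ih (by omega) y hMy (hDE (by simp)))
  exact hind' n le_rfl l hl (hun ▸ hb)

lemma walk_lemma {V : Type*} [DecidableEq V] (G : SimpleGraph V) {p : ℕ} (C : Fin p → Finset V)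
    (hcl : ∀ ℓ, G.IsClique (C ℓ : Set V)) (M : Finset V) (v : V)
    (T T' : SimpleGraph (Fin p)) {i a : Fin p} (w : T.Walk i a)
    (hw : ∀ x y, s(x, y) ∈ w.edges → T'.Adj x y ∧ (C x ∩ C y = M ∨ ¬ C x ∩ C y ⊆ M))
    (hi : ∃ z ∈ C i, z ∉ M ∧ (awayFrom G M).Reachable v z) (ha : M ⊆ C a) :
    ∃ k, T'.Reachable i k ∧ M ⊆ C k ∧ ∃ z ∈ C k, z ∉ M ∧ (awayFrom G M).Reachable v z := by
  induction w with
  | nil => exact ⟨_, Reachable.refl _, ha, hi⟩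
  | @cons i j a h w ih =>
    obtain ⟨hT, hor⟩ := hw i j (by simp)
    rcases hor with h1 | h1
    · refine ⟨i, Reachable.refl _, ?_, hi⟩
      rw [← h1]; exact Finset.inter_subset_left
    · obtain ⟨z, hz, hzM, hvz⟩ := hi
      obtain ⟨y, hy, hyM⟩ := Finset.not_subset.1 h1
      rw [Finset.mem_inter] at hy
      obtain ⟨k, hk, hrest⟩ := ih (fun x y hxy => hw x y (by simp [hxy])) ⟨y, hy.2, hyM, by
        by_cases hzy : z = y
        · exact hzy ▸ hvz
        · refine hvz.trans (Adj.reachable ?_)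
          exact ⟨hcl i hz hy.1 hzy, hzM, hyM⟩⟩ ha
      exact ⟨k, hT.reachable.trans hk, hrest⟩

lemma treeWeight_sup_edge {V : Type*} [DecidableEq V] {p : ℕ} (C : Fin p → Finset V)
    (T : SimpleGraph (Fin p)) (x y : Fin p) (hxy : x ≠ y) (hn : ¬ T.Adj x y) :
    treeWeight C (T ⊔ edge x y) = treeWeight C T + 2 * (C x ∩ C y).card := by
  classical
  have hn' : ¬ T.Adj y x := fun h => hn h.symm
  unfold treeWeight
  have : ∀ l m, (if (T ⊔ edge x y).Adj l m then (C l ∩ C m).card else 0) =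
      (if T.Adj l m then (C l ∩ C m).card else 0) +
      ((if l = x then (if m = y then (C x ∩ C y).card else 0) else 0) +
       (if l = y then (if m = x then (C x ∩ C y).card else 0) else 0)) := by
    intro l m
    simp only [sup_adj, edge_adj]
    by_cases h1 : l = x
    · subst h1
      by_cases h2 : m = y
      · subst h2; simp [hn, hxy]
      · simp [h2, hxy]
    · by_cases h2 : l = y
      · subst h2
        by_cases h3 : m = x
        · subst h3; simp [hn', h1, Finset.inter_comm]
        · simp [h1, h3]
      · simp [h1, h2]
  refine (Finset.sum_congr rfl fun l _ => Finset.sum_congr rfl fun m _ =>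
    (Eq.trans (by congr) (this l m))).trans ?_
  simp only [Finset.sum_add_distrib]
  simp
  ring

lemma exchange {p : ℕ} (T : SimpleGraph (Fin p)) (hT : T.IsTree) (a b x y : Fin p)
    (hxy : ¬ (T.deleteEdges {s(a, b)}).Reachable x y) :
    (T.deleteEdges {s(a, b)} ⊔ edge x y).IsTree := by
  set T' := T.deleteEdges {s(a, b)} with hT'
  have hne : x ≠ y := by rintro rfl; exact hxy (Reachable.refl _)
  have hle : T' ≤ T := deleteEdges_le _
  have hac : (T' ⊔ edge x y).IsAcyclic :=
    IsAcyclic.sup_edge_of_not_reachable hxy (hT.2.anti hle)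
  have hside : ∀ z w, T.Walk z w → w = a → T'.Reachable z a ∨ T'.Reachable z b := by
    intro z w W
    induction W with
    | nil => rintro rfl; exact Or.inl (Reachable.refl _)
    | @cons z z' w h W ih =>
      intro hw
      by_cases he : s(z, z') = s(a, b)
      · rcases Sym2.eq_iff.1 he with ⟨rfl, rfl⟩ | ⟨rfl, rfl⟩
        · exact Or.inl (Reachable.refl _)
        · exact Or.inr (Reachable.refl _)
      · have : T'.Adj z z' := by simp only [hT', deleteEdges_adj]; exact ⟨h, he⟩
        exact (ih hw).imp this.reachable.trans this.reachable.trans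
  have hside' : ∀ z, T'.Reachable z a ∨ T'.Reachable z b := fun z =>
    (hT.1.preconnected z a).elim fun W => hside z a W rfl
  have hle' : T' ≤ T' ⊔ edge x y := le_sup_left
  have hxy' : (T' ⊔ edge x y).Reachable x y :=
    Adj.reachable (by simp [edge_adj, hne])
  have hab : (T' ⊔ edge x y).Reachable a b := by
    rcases hside' x with h1 | h1 <;> rcases hside' y with h2 | h2
    · exact absurd (h1.trans h2.symm) hxy
    · exact ((h1.symm.mono hle').trans hxy').trans (h2.mono hle')
    · exact ((h2.symm.mono hle').trans hxy'.symm).trans (h1.mono hle')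
    · exact absurd (h1.trans h2.symm) hxy
  have htoa : ∀ z, (T' ⊔ edge x y).Reachable z a := fun z =>
    (hside' z).elim (fun h => h.mono hle') (fun h => (h.mono hle').trans hab.symm)
  have := hT.1.nonempty
  exact ⟨⟨fun z w => (htoa z).trans (htoa w).symm⟩, hac⟩

/-- **Maximum weight spanning trees of the clique graph are clique trees.** Any
maximum weight spanning tree of the clique graph of a connected chordal graph,
with edge weights `|C_i ∩ C_j|`, satisfies the running-intersection property. -/
theorem max_weight_spanning_tree_is_clique_tree {V : Type*} [Fintype V] [DecidableEq V]
    (G : SimpleGraph V) (hchord : IsChordal G) (hconn : G.Connected)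
    {p : ℕ} (C : Fin p → Finset V)
    (hmax : ∀ ℓ, IsMaxClique G (C ℓ))
    (hcov : ∀ D : Finset V, IsMaxClique G D → ∃ ℓ, C ℓ = D)
    (hinj : Function.Injective C)
    (H : SimpleGraph (Fin p))
    (hH : H = SimpleGraph.fromRel (fun ℓ m => (C ℓ ∩ C m).Nonempty))
    (T : SimpleGraph (Fin p)) (hsub : T ≤ H) (hT : T.IsTree)
    (hmaxweight : ∀ T' : SimpleGraph (Fin p), T' ≤ H → T'.IsTree →
      treeWeight C T' ≤ treeWeight C T) :
    RIP T C := by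
  classical
  intro i j w hw k hk v hv
  by_contra hvk
  rw [Finset.mem_inter] at hv
  -- an edge of the path missing `v`
  have hex : ∃ d ∈ w.darts, v ∉ C d.fst ∩ C d.snd := by
    rw [← Walk.cons_map_snd_darts, List.mem_cons, List.mem_map] at hk
    rcases hk with rfl | ⟨d, hd, rfl⟩
    · exact absurd hv.1 hvk
    · exact ⟨d, hd, fun h => hvk (Finset.mem_inter.1 h).2⟩
  obtain ⟨d, hd, hdmin⟩ := Finset.exists_min_image
    (w.darts.toFinset.filter fun d => v ∉ C d.fst ∩ C d.snd)
    (fun d => (C d.fst ∩ C d.snd).card) (by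
      obtain ⟨d, hd, h⟩ := hex
      exact ⟨d, by simp only [Finset.mem_filter, List.mem_toFinset]; exact ⟨hd, h⟩⟩)
  simp only [Finset.mem_filter, List.mem_toFinset] at hd hdmin
  obtain ⟨hdw, hvM⟩ := hd
  obtain ⟨⟨a, b⟩, hadj⟩ := d
  simp only at hdw hvM hdmin hadj
  obtain ⟨M, hM⟩ : ∃ M, M = C a ∩ C b := ⟨_, rfl⟩
  rw [← hM] at hvM hdmin
  obtain ⟨T', hT'⟩ : ∃ T', T' = T.deleteEdges {s(a, b)} := ⟨_, rfl⟩
  have hbr : ¬ T'.Reachable a b := by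
    rw [hT']
    exact isBridge_iff.1 (isAcyclic_iff_forall_adj_isBridge.1 hT.2 hadj)
  have hedge : ∀ x y, s(x, y) ∈ w.edges → C x ∩ C y = M ∨ ¬ C x ∩ C y ⊆ M := by
    intro x y hxy
    by_contra hcon
    push Not at hcon
    obtain ⟨hne, hss⟩ := hcon
    have hvxy : v ∉ C x ∩ C y := fun h => hvM (hss h)
    obtain ⟨⟨⟨x', y'⟩, hd'⟩, hd1, hd2⟩ := List.mem_map.1 hxy
    have hcard := hdmin ⟨⟨x', y'⟩, hd'⟩
    have hd2' : s(x', y') = s(x, y) := hd2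
    have hEq : C x' ∩ C y' = C x ∩ C y := by
      rcases Sym2.eq_iff.1 hd2' with ⟨rfl, rfl⟩ | ⟨rfl, rfl⟩
      · rfl
      · exact Finset.inter_comm _ _
    simp only [hEq] at hcard
    exact hne (Finset.eq_of_subset_of_card_le hss (hcard ⟨hd1, hvxy⟩))
  obtain ⟨w1, w2, hw12⟩ := (Walk.isSubwalk_toWalk_iff_mem_darts w hadj).2 hdw
  have hnd := hw.isTrail.edges_nodup
  rw [hw12] at hnd
  simp only [Walk.edges_append] at hnd
  have hsub1 : ∀ e ∈ w1.edges, e ∈ w.edges ∧ e ≠ s(a, b) := by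
    intro e he
    refine ⟨by rw [hw12]; simp [he], ?_⟩
    rintro rfl
    simp [List.nodup_append] at hnd
    grind
  have hsub2 : ∀ e ∈ w2.edges, e ∈ w.edges ∧ e ≠ s(a, b) := by
    intro e he
    refine ⟨by rw [hw12]; simp [he], ?_⟩
    rintro rfl
    simp [List.nodup_append] at hnd
    grind
  have hTadj : ∀ x y, s(x, y) ∈ w.edges → s(x, y) ≠ s(a, b) → T'.Adj x y := by
    intro x y h1 h2
    rw [hT', deleteEdges_adj]
    exact ⟨w.adj_of_mem_edges h1, h2⟩
  have r1 : T'.Reachable i a :=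
    ⟨w1.transfer T' (by
      intro e he
      induction e with
      | h x y => exact hTadj x y (hsub1 _ he).1 (hsub1 _ he).2)⟩
  have r2 : T'.Reachable j b :=
    ⟨w2.reverse.transfer T' (by
      intro e he
      rw [Walk.edges_reverse, List.mem_reverse] at he
      induction e with
      | h x y => exact hTadj x y (hsub2 _ he).1 (hsub2 _ he).2)⟩
  obtain ⟨k1, hk1, hMk1, z1, hz1, hz1M, hvz1⟩ := walk_lemma G C (fun l => (hmax l).1) M v T T' w1
    (fun x y h => ⟨hTadj x y (hsub1 _ h).1 (hsub1 _ h).2, hedge x y (hsub1 _ h).1⟩)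
    ⟨v, hv.1, hvM, Reachable.refl _⟩ (hM ▸ Finset.inter_subset_left)
  obtain ⟨k2, hk2, hMk2, z2, hz2, hz2M, hvz2⟩ := walk_lemma G C (fun l => (hmax l).1) M v T T'
    w2.reverse
    (fun x y h => by
      rw [Walk.edges_reverse, List.mem_reverse] at h
      exact ⟨hTadj x y (hsub2 _ h).1 (hsub2 _ h).2, hedge x y (hsub2 _ h).1⟩)
    ⟨v, hv.2, hvM, Reachable.refl _⟩ (hM ▸ Finset.inter_subset_right)
  have hcross := chain_lemma G hchord C hmax hcov M k1 k2 hMk1 hMk2 z1 z2 hz1 hz1M hz2 hz2M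
    (hvz1.symm.trans hvz2) (fun x => T'.Reachable a x) (by
      intro x y hcard hx
      by_contra hy
      have hxy : ¬ T'.Reachable x y := fun h => hy (hx.trans h)
      have hne : x ≠ y := by rintro rfl; exact hy hx
      have htree := exchange T hT a b x y (hT' ▸ hxy)
      rw [← hT'] at htree
      have hle : T' ⊔ edge x y ≤ H := by
        refine sup_le ((hT' ▸ deleteEdges_le _).trans hsub) ?_
        intro c d hcd
        have hnon : (C x ∩ C y).Nonempty := Finset.card_pos.1 (by omega)
        rw [edge_adj] at hcd
        rw [hH, fromRel_adj]
        refine ⟨hcd.2, ?_⟩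
        rcases hcd.1 with ⟨rfl, rfl⟩ | ⟨rfl, rfl⟩
        · exact Or.inl hnon
        · exact Or.inr hnon
      have hwt := hmaxweight _ hle htree
      rw [treeWeight_sup_edge C T' x y hne (fun h => hxy h.reachable)] at hwt
      have hTeq : T = T' ⊔ edge a b := by
        ext c d
        simp only [hT', sup_adj, deleteEdges_adj, edge_adj, Set.mem_singleton_iff, Sym2.eq_iff]
        constructor
        · intro h
          by_cases h' : c = a ∧ d = b ∨ c = b ∧ d = a
          · exact Or.inr ⟨h', h.ne⟩
          · exact Or.inl ⟨h, h'⟩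
        · rintro (h | ⟨⟨rfl, rfl⟩ | ⟨rfl, rfl⟩, _⟩)
          · exact h.1
          · exact hadj
          · exact hadj.symm
      have hwT := treeWeight_sup_edge C T' a b hadj.ne (fun h => hbr h.reachable)
      rw [← hTeq, ← hM] at hwT
      omega) (r1.symm.trans hk1)
  exact hbr ((hcross.trans hk2.symm).trans r2)
end

section
/- If the Cholesky (lower triangular) factor L of a symmetric positive definite matrix has nonzero pattern F (below the diagonal), then the graph with edge set F ⊇ E is chordal, where E is the nonzero pattern of the original matrix; i.e., a symbolic Cholesky factorisation yields a chordal extension of the sparsity graph. -/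
open Matrix

/-- **Symbolic Cholesky factorisation yields a chordal extension.** Let `M ⪰ 0` be
positive definite with `M = L Lᵀ`, `L` lower triangular. Assume no accidental
cancellation, i.e. the pattern of `L` is the filled pattern of the elimination
ordering: it is closed under the fill rule and contains the pattern of `M`. Then
the filled graph (edges at nonzeros of `L` below the diagonal) is chordal and
contains the sparsity graph of `M`. -/
theorem cholesky_fill_in_is_chordal {n : ℕ}
    (M L : Matrix (Fin n) (Fin n) ℝ) (hM : M.PosDef)
    (hlow : ∀ i j : Fin n, i < j → L i j = 0)
    (hfac : M = L * Lᵀ)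
    -- no accidental cancellation: the fill rule holds for the actual nonzeros of `L`
    (hfill : ∀ i j k : Fin n, k < j → j < i → L i k ≠ 0 → L j k ≠ 0 → L i j ≠ 0)
    -- no accidental cancellation: the pattern of `M` is contained in that of `L`
    (hML : ∀ i j : Fin n, j < i → M i j ≠ 0 → L i j ≠ 0)
    (GE GF : SimpleGraph (Fin n))
    (hGE : GE = SimpleGraph.fromRel (fun i j => j < i ∧ M i j ≠ 0))
    (hGF : GF = SimpleGraph.fromRel (fun i j => j < i ∧ L i j ≠ 0)) :
    IsChordal GF ∧ GE ≤ GF := by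
  subst hGE hGF
  refine ⟨?_, ?_⟩
  · intro m hm f hf hadj
    haveI : NeZero m := ⟨by omega⟩
    obtain ⟨k, hk⟩ := Finite.exists_min f
    have small : ∀ c : ℕ, 0 < c → c ≤ 3 → (c : ZMod m) ≠ 0 := by
      intro c hc hc3 h
      rw [ZMod.natCast_eq_zero_iff] at h
      have := Nat.le_of_dvd hc h
      omega
    have h1 : (1 : ZMod m) ≠ 0 := by simpa using small 1 (by norm_num) (by norm_num)
    have h2 : (2 : ZMod m) ≠ 0 := by simpa using small 2 (by norm_num) (by norm_num)
    have h3 : (3 : ZMod m) ≠ 0 := by simpa using small 3 (by norm_num) (by norm_num)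
    have hne : k - 1 ≠ k + 1 := fun h => h2 (by linear_combination -h)
    have hA := hadj k
    have hB := hadj (k - 1)
    rw [sub_add_cancel] at hB
    have hkA := hk (k + 1)
    have hkB := hk (k - 1)
    have hneF : f (k - 1) ≠ f (k + 1) := fun h => hne (hf h)
    rw [SimpleGraph.fromRel_adj] at hA hB
    have hLA : f k < f (k + 1) ∧ L (f (k + 1)) (f k) ≠ 0 := by
      rcases hA.2 with h | h
      · exact absurd h.1 (not_lt.mpr hkA)
      · exact h
    have hLB : f k < f (k - 1) ∧ L (f (k - 1)) (f k) ≠ 0 := by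
      rcases hB.2 with h | h
      · exact h
      · exact absurd h.1 (not_lt.mpr hkB)
    refine ⟨k - 1, k + 1, hne, fun h => h1 (by linear_combination h),
      fun h => h3 (by linear_combination -h), ?_⟩
    rw [SimpleGraph.fromRel_adj]
    refine ⟨hneF, ?_⟩
    rcases lt_or_gt_of_ne hneF with h | h
    · exact Or.inr ⟨h, hfill _ _ _ hLB.1 h hLA.2 hLB.2⟩
    · exact Or.inl ⟨h, hfill _ _ _ hLA.1 h hLB.2 hLA.2⟩
  · intro a b h
    rw [SimpleGraph.fromRel_adj] at h ⊢
    exact ⟨h.1, h.2.imp (fun h => ⟨h.1, hML _ _ h.1 h.2⟩) (fun h => ⟨h.1, hML _ _ h.1 h.2⟩)⟩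
end
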